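/- For every fixed real σ, the factor F₆ in the functional equation of Δ₆ tends to e^(iπ/4) along vertical lines: the function t ↦ F₆(σ + i·t) = D(σ + i·t)/D(1 − σ − i·t) tends to exp(iπ/4) as the real variable t → +∞ (along Filter.atTop). -/

import Mathlib

open Filter

noncomputable def D (s : ℂ) : ℂ :=
  ((Real.pi ^ (-(1/4) : ℝ) : ℝ) * Complex.Gamma s +
    (Real.pi ^ ((1/4) : ℝ) : ℝ) * Complex.Gamma (s - 1/2)) / Complex.Gamma (s - 1/4)

noncomputable def F₆ (s : ℂ) : ℂ := D s / D (1 - s)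

theorem Complex.Gamma_ne_zero_of_im_ne_zero {s : ℂ} (hs : s.im ≠ 0) : Complex.Gamma s ≠ 0 :=
  Complex.Gamma_ne_zero fun m h => hs (by simp [h])

theorem Complex.GammaSeq_sq_div_eq_prod {s : ℂ} (hs : s.im ≠ 0) (a : ℝ) {n : ℕ} (hn : n ≠ 0) :
    Complex.GammaSeq s n ^ 2 / (Complex.GammaSeq (s - a) n * Complex.GammaSeq (s + a) n) =
      ∏ j ∈ Finset.range (n + 1), (1 + -((a : ℂ) ^ 2 / (s + j) ^ 2)) := by
  have hne : ∀ (b : ℝ) (j : ℕ), s + b + j ≠ 0 := fun b j h => hs (by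
    have := congrArg Complex.im h
    simpa using this)
  have hne' : ∀ j : ℕ, s + j ≠ 0 := fun j => by simpa using hne 0 j
  have hnes : ∀ j : ℕ, s - a + j ≠ 0 := fun j => by simpa [sub_eq_add_neg] using hne (-a) j
  have hn' : (n : ℂ) ≠ 0 := Nat.cast_ne_zero.mpr hn
  have hfac : (n.factorial : ℂ) ≠ 0 := Nat.cast_ne_zero.mpr n.factorial_ne_zero
  have hprod : ∏ j ∈ Finset.range (n + 1), (1 + -((a : ℂ) ^ 2 / (s + j) ^ 2)) =
      (∏ j ∈ Finset.range (n + 1), (s - a + j)) * (∏ j ∈ Finset.range (n + 1), (s + a + j)) /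
        (∏ j ∈ Finset.range (n + 1), (s + j)) ^ 2 := by
    rw [← Finset.prod_mul_distrib, ← Finset.prod_pow, ← Finset.prod_div_distrib]
    refine Finset.prod_congr rfl fun j _ => ?_
    have := hne' j
    field_simp
    ring
  have h0 := Finset.prod_ne_zero_iff.mpr fun j (_ : j ∈ Finset.range (n + 1)) => hne' j
  have h1 := Finset.prod_ne_zero_iff.mpr fun j (_ : j ∈ Finset.range (n + 1)) => hne a j
  have h2 := Finset.prod_ne_zero_iff.mpr fun j (_ : j ∈ Finset.range (n + 1)) => hnes j
  have hpow : (n : ℂ) ^ (s - a) * (n : ℂ) ^ (s + a) = ((n : ℂ) ^ s) ^ 2 := by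
    rw [← Complex.cpow_add _ _ hn', sq, ← Complex.cpow_add _ _ hn']
    congr 1
    ring
  have hns : (n : ℂ) ^ s ≠ 0 := by simp [Complex.cpow_eq_zero_iff, hn']
  rw [hprod, Complex.GammaSeq, Complex.GammaSeq, Complex.GammaSeq, div_mul_div_comm,
    mul_mul_mul_comm, hpow]
  field_simp

theorem summable_one_div_add_nat_sq_add_sq (σ t : ℝ) :
    Summable fun j : ℕ => 1 / ((σ + j) ^ 2 + t ^ 2) := by
  refine Summable.of_norm_bounded_eventually_nat
    ((Real.summable_one_div_nat_add_rpow σ 2).mpr one_lt_two) ?_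
  filter_upwards [tendsto_natCast_atTop_atTop.eventually_gt_atTop (-σ)] with j hj
  have hpos : 0 < (j : ℝ) + σ := by linarith
  rw [Real.norm_of_nonneg (by positivity), Real.rpow_two, sq_abs, add_comm σ]
  gcongr
  nlinarith [sq_nonneg t]

theorem Complex.norm_Gamma_sq_div_sub_one_le (a σ : ℝ) {t : ℝ} (ht : t ≠ 0) :
    ‖Complex.Gamma (σ + t * Complex.I) ^ 2 /
        (Complex.Gamma (σ + t * Complex.I - a) * Complex.Gamma (σ + t * Complex.I + a)) - 1‖ ≤
      Real.exp (a ^ 2 * ∑' j : ℕ, 1 / ((σ + j) ^ 2 + t ^ 2)) - 1 := by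
  set s : ℂ := σ + t * Complex.I with hs
  have him : s.im ≠ 0 := by simpa [hs] using ht
  have hlim := (((Complex.GammaSeq_tendsto_Gamma s).pow 2).div
    ((Complex.GammaSeq_tendsto_Gamma (s - a)).mul (Complex.GammaSeq_tendsto_Gamma (s + a)))
    (mul_ne_zero (Complex.Gamma_ne_zero_of_im_ne_zero (by simpa using him))
      (Complex.Gamma_ne_zero_of_im_ne_zero (by simpa using him)))).sub_const 1
  refine le_of_tendsto hlim.norm ?_
  filter_upwards [eventually_ne_atTop 0] with n hn
  simp only [Pi.div_apply]
  rw [Complex.GammaSeq_sq_div_eq_prod him a hn]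
  refine (Finset.norm_prod_one_add_sub_one_le _ _).trans ?_
  gcongr
  have hterm : ∀ j : ℕ, ‖-((a : ℂ) ^ 2 / (s + j) ^ 2)‖ = a ^ 2 * (1 / ((σ + j) ^ 2 + t ^ 2)) := by
    intro j
    rw [norm_neg, norm_div, norm_pow, norm_pow, Complex.norm_real, Real.norm_eq_abs, sq_abs,
      ← Complex.normSq_eq_norm_sq, Complex.normSq_apply, mul_one_div]
    simp [hs, sq]
  simp only [hterm, ← Finset.mul_sum]
  gcongr
  exact (summable_one_div_add_nat_sq_add_sq σ t).sum_le_tsum _ fun j _ => by positivity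

theorem tendsto_tsum_one_div_add_nat_sq_add_sq (σ : ℝ) :
    Tendsto (fun t : ℝ => ∑' j : ℕ, 1 / ((σ + j) ^ 2 + t ^ 2)) (cocompact ℝ) (nhds 0) := by
  have habs : Tendsto (fun t : ℝ => |t|) (cocompact ℝ) atTop := tendsto_norm_cocompact_atTop
  have hsq : Tendsto (fun t : ℝ => t ^ 2) (cocompact ℝ) atTop := by
    simpa only [Function.comp_def, sq_abs] using (tendsto_pow_atTop (α := ℝ) two_ne_zero).comp habs
  rw [← tsum_zero (α := ℝ) (β := ℕ)]
  refine tendsto_tsum_of_dominated_convergence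
    (summable_one_div_add_nat_sq_add_sq σ 1) (fun j => ?_) ?_
  · simp only [one_div]
    exact (tendsto_atTop_add_const_left _ ((σ + (j : ℝ)) ^ 2) hsq).inv_tendsto_atTop
  · filter_upwards [hsq.eventually_ge_atTop 1] with t ht j
    rw [Real.norm_of_nonneg (by positivity)]
    refine one_div_le_one_div_of_le (by positivity) ?_
    rw [one_pow]
    linarith

theorem Complex.tendsto_Gamma_sq_div_cocompact (a σ : ℝ) :
    Tendsto (fun t : ℝ => Complex.Gamma (σ + t * Complex.I) ^ 2 /
        (Complex.Gamma (σ + t * Complex.I - a) * Complex.Gamma (σ + t * Complex.I + a)))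
      (cocompact ℝ) (nhds 1) := by
  have hbound : Tendsto (fun t : ℝ =>
      Real.exp (a ^ 2 * ∑' j : ℕ, 1 / ((σ + j) ^ 2 + t ^ 2)) - 1) (cocompact ℝ) (nhds 0) := by
    simpa using ((tendsto_tsum_one_div_add_nat_sq_add_sq σ).const_mul (a ^ 2)).rexp.sub_const 1
  rw [tendsto_iff_norm_sub_tendsto_zero]
  refine squeeze_zero' (Eventually.of_forall fun _ => norm_nonneg _) ?_ hbound
  filter_upwards [(tendsto_norm_cocompact_atTop (E := ℝ)).eventually_gt_atTop 0] with t ht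
  exact Complex.norm_Gamma_sq_div_sub_one_le a σ (norm_pos_iff.mp ht)

theorem Complex.tendsto_Gamma_sub_half_div_Gamma_cocompact (σ : ℝ) :
    Tendsto (fun t : ℝ => Complex.Gamma (σ + t * Complex.I - 1 / 2) /
      Complex.Gamma (σ + t * Complex.I)) (cocompact ℝ) (nhds 0) := by
  have hinv : Tendsto (fun t : ℝ => ((σ : ℂ) + t * Complex.I - 1 / 2)⁻¹)
      (cocompact ℝ) (nhds 0) := by
    refine squeeze_zero_norm' (a := fun t : ℝ => ‖t‖⁻¹) ?_
      tendsto_norm_cocompact_atTop.inv_tendsto_atTop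
    filter_upwards [(tendsto_norm_cocompact_atTop (E := ℝ)).eventually_gt_atTop 0] with t ht
    rw [norm_inv]
    gcongr
    simpa using Complex.abs_im_le_norm ((σ : ℂ) + t * Complex.I - 1 / 2)
  have hprod := ((Complex.tendsto_Gamma_sq_div_cocompact (1 / 2) σ).inv₀ one_ne_zero).mul hinv
  rw [mul_zero] at hprod
  suffices h : Tendsto (fun t : ℝ => (Complex.Gamma (σ + t * Complex.I - 1 / 2) /
      Complex.Gamma (σ + t * Complex.I)) ^ 2) (cocompact ℝ) (nhds 0) by
    rw [tendsto_zero_iff_norm_tendsto_zero] at h ⊢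
    simpa only [norm_pow, Real.sqrt_sq (norm_nonneg _), Real.sqrt_zero] using h.sqrt
  refine hprod.congr' ?_
  filter_upwards [(tendsto_norm_cocompact_atTop (E := ℝ)).eventually_gt_atTop 0] with t ht
  have him : ((σ : ℂ) + t * Complex.I - 1 / 2).im ≠ 0 := by simpa using ht
  have hne : (σ : ℂ) + t * Complex.I - 1 / 2 ≠ 0 := fun h => him (by rw [h, Complex.zero_im])
  have hadd := Complex.Gamma_add_one _ hne
  rw [show (σ : ℂ) + t * Complex.I - 1 / 2 + 1 = σ + t * Complex.I + 1 / 2 by ring] at hadd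
  have h0 := Complex.Gamma_ne_zero_of_im_ne_zero him
  have h1 : Complex.Gamma (σ + t * Complex.I) ≠ 0 :=
    Complex.Gamma_ne_zero_of_im_ne_zero (by simpa using ht)
  push_cast
  rw [hadd, inv_div]
  generalize (σ : ℂ) + t * Complex.I - 1 / 2 = z at *
  field_simp

theorem Complex.tendsto_sin_div_sin_add_quarter (σ : ℝ) :
    Tendsto (fun t : ℝ => Complex.sin (Real.pi * (σ + t * Complex.I)) /
        Complex.sin (Real.pi * (σ + t * Complex.I + 1 / 4))) atTop
      (nhds (Complex.exp (Real.pi / 4 * Complex.I))) := by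
  have hw : Tendsto (fun t : ℝ => Complex.exp (2 * Real.pi * (σ + t * Complex.I) * Complex.I))
      atTop (nhds 0) := by
    rw [tendsto_zero_iff_norm_tendsto_zero]
    have : Tendsto (fun t : ℝ => Real.exp (-(2 * Real.pi * t))) atTop (nhds 0) :=
      Real.tendsto_exp_neg_atTop_nhds_zero.comp
        (tendsto_id.const_mul_atTop (by positivity))
    refine this.congr fun t => ?_
    rw [Complex.norm_exp]
    simp
  have hlim := (hw.const_sub 1).div
    ((hw.mul_const (Complex.exp (Real.pi / 4 * Complex.I))).const_sub
      (Complex.exp (-(Real.pi / 4 * Complex.I))))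
    (by simp [Complex.exp_ne_zero])
  have hval : (1 - 0) / (Complex.exp (-(Real.pi / 4 * Complex.I)) -
      0 * Complex.exp (Real.pi / 4 * Complex.I)) = Complex.exp (Real.pi / 4 * Complex.I) := by
    simp [Complex.exp_neg]
  rw [hval] at hlim
  refine hlim.congr fun t => ?_
  set z : ℂ := Real.pi * (σ + t * Complex.I) with hz
  have h2 : Complex.exp (2 * Real.pi * (σ + t * Complex.I) * Complex.I) =
      Complex.exp (z * Complex.I) ^ 2 := by
    rw [← Complex.exp_nat_mul]
    congr 1
    rw [hz]
    push_cast
    ring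
  have h4 : (Real.pi : ℂ) * (σ + t * Complex.I + 1 / 4) = z + Real.pi / 4 := by rw [hz]; ring
  simp only [Pi.div_apply]
  rw [h4, Complex.sin, Complex.sin, h2]
  simp only [add_mul, neg_mul, Complex.exp_add, Complex.exp_neg]
  have hE := Complex.exp_ne_zero (z * Complex.I)
  have hfac : (Complex.exp (z * Complex.I))⁻¹ * (Complex.I / 2) ≠ 0 :=
    mul_ne_zero (inv_ne_zero hE) (by simp)
  rw [← mul_div_mul_left _ _ hfac]
  congr 1 <;> field_simp

theorem D_eq_Gamma_div_mul {s : ℂ} (hs : s.im ≠ 0) :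
    D s = (Real.pi ^ (-(1/4) : ℝ) : ℝ) * (Complex.Gamma s / Complex.Gamma (s - 1/4)) *
      (1 + (Real.pi ^ ((1/2) : ℝ) : ℝ) * (Complex.Gamma (s - 1/2) / Complex.Gamma s)) := by
  have h : (Real.pi ^ ((1/4) : ℝ) : ℝ) =
      Real.pi ^ (-(1/4) : ℝ) * Real.pi ^ ((1/2) : ℝ) := by
    rw [← Real.rpow_add Real.pi_pos]
    norm_num
  have h0 := Complex.Gamma_ne_zero_of_im_ne_zero hs
  rw [D, h]
  push_cast
  field_simp

theorem Complex.Gamma_div_Gamma_sub_quarter_reflection {s : ℂ} (hs : s.im ≠ 0) :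
    Complex.Gamma s / Complex.Gamma (s - 1/4) /
        (Complex.Gamma (1 - s) / Complex.Gamma (1 - s - 1/4)) =
      Complex.sin (Real.pi * s) / Complex.sin (Real.pi * (s + 1/4)) *
        (Complex.Gamma s ^ 2 / (Complex.Gamma (s - 1/4) * Complex.Gamma (s + 1/4))) := by
  have h0 := Complex.Gamma_ne_zero_of_im_ne_zero hs
  have h2 : Complex.Gamma (s + 1/4) ≠ 0 :=
    Complex.Gamma_ne_zero_of_im_ne_zero (by simpa using hs)
  have hpi : (Real.pi : ℂ) ≠ 0 := Complex.ofReal_ne_zero.mpr Real.pi_ne_zero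
  have hsin : ∀ z : ℂ, Complex.sin (Real.pi * z) =
      Real.pi / (Complex.Gamma z * Complex.Gamma (1 - z)) := by
    intro z
    rw [Complex.Gamma_mul_Gamma_one_sub, div_div_cancel₀ hpi]
  rw [hsin s, hsin (s + 1/4), show 1 - s - 1/4 = 1 - (s + 1/4) by ring]
  generalize Complex.Gamma (1 - (s + 1/4)) = u at *
  generalize Complex.Gamma (s + 1/4) = v at *
  generalize Complex.Gamma (s - 1/4) = w at *
  field_simp

theorem F6_limit_vertical_lines (σ : ℝ) :
    Tendsto (fun t : ℝ => F₆ ((σ : ℂ) + t * Complex.I)) atTop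
      (nhds (Complex.exp (Real.pi / 4 * Complex.I))) := by
  have hcorr : ∀ σ : ℝ, Tendsto (fun t : ℝ => 1 + ((Real.pi ^ ((1/2) : ℝ) : ℝ) : ℂ) *
      (Complex.Gamma (σ + t * Complex.I - 1/2) / Complex.Gamma (σ + t * Complex.I)))
      (cocompact ℝ) (nhds 1) := fun σ => by
    simpa using ((Complex.tendsto_Gamma_sub_half_div_Gamma_cocompact σ).const_mul
      ((Real.pi ^ ((1/2) : ℝ) : ℝ) : ℂ)).const_add 1
  have hmain := (Complex.tendsto_sin_div_sin_add_quarter σ).mul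
    ((Complex.tendsto_Gamma_sq_div_cocompact (1/4) σ).mono_left atTop_le_cocompact)
  have hlim := hmain.mul (((hcorr σ).mono_left atTop_le_cocompact).div
    ((hcorr (1 - σ)).comp (tendsto_neg_atTop_atBot.mono_right atBot_le_cocompact)) one_ne_zero)
  rw [mul_one, div_one, mul_one] at hlim
  refine hlim.congr' ?_
  filter_upwards [eventually_ne_atTop 0] with t ht
  have him : ((σ : ℂ) + t * Complex.I).im ≠ 0 := by simpa using ht
  have hc : ((Real.pi ^ (-(1/4) : ℝ) : ℝ) : ℂ) ≠ 0 :=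
    Complex.ofReal_ne_zero.mpr (Real.rpow_pos_of_pos Real.pi_pos _).ne'
  rw [F₆, D_eq_Gamma_div_mul him, D_eq_Gamma_div_mul (by simpa using ht), mul_div_mul_comm,
    mul_div_mul_left _ _ hc, Complex.Gamma_div_Gamma_sub_quarter_reflection him]
  have hone : ((1 - σ : ℝ) : ℂ) + ((-t : ℝ) : ℂ) * Complex.I = 1 - (σ + t * Complex.I) := by
    push_cast
    ring
  simp only [Pi.div_apply, Function.comp_apply, hone]
  push_cast
  rfl
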